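/- For every k ≥ 3 and 1 ≤ t ≤ k-1, there exists a t-intersecting family F of k-element subsets of [2k - t + 1] such that every subset of [2k - 2t + 2] of size at most k - t belongs to D(F). -/

import Mathlib

/-- The family of `m`-subsets of `[2m]` satisfying `c` contains exactly one set of each
complementary pair, and contains some but not all `m`-supersets of every `(m-1)`-set. -/
def IsBalancedColoring (m : ℕ) (c : Finset ℕ → Prop) : Prop :=
  (∀ A ⊆ Finset.Icc 1 (2 * m), A.card = m → (c (Finset.Icc 1 (2 * m) \ A) ↔ ¬ c A)) ∧
  (∀ X ⊆ Finset.Icc 1 (2 * m), X.card + 1 = m →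
    ∃ p ∈ Finset.Icc 1 (2 * m) \ X, ∃ q ∈ Finset.Icc 1 (2 * m) \ X,
      c (insert p X) ∧ ¬ c (insert q X))

lemma odd_card_insert_inter_of_mem {α : Type*} [DecidableEq α] {X T : Finset α} {p : α}
    (hX : p ∉ X) (hT : p ∈ T) :
    Odd (insert p X ∩ T).card ↔ ¬ Odd (X ∩ T).card := by
  rw [Finset.insert_inter_of_mem hT, Finset.card_insert_of_notMem (by simp [hX]), Nat.odd_add_one]

lemma card_inter_add_card_sdiff_inter {α : Type*} [DecidableEq α] {V T : Finset α} (hT : T ⊆ V)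
    (A : Finset α) : (A ∩ T).card + ((V \ A) ∩ T).card = T.card := by
  have h : (V \ A) ∩ T = T \ A := by grind
  rw [h, Finset.inter_comm, Finset.card_inter_add_card_sdiff]

lemma exists_isBalancedColoring_of_odd {m : ℕ} (hm : Odd m) :
    ∃ c, IsBalancedColoring m c := by
  refine ⟨fun A => Odd (A ∩ Finset.Icc 1 m).card, ?_, ?_⟩
  · intro A _ _
    have h := card_inter_add_card_sdiff_inter
      (show Finset.Icc 1 m ⊆ Finset.Icc 1 (2 * m) by intro; simp; omega) A
    simp only [Nat.card_Icc] at h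
    grind
  · intro X _ hc
    obtain ⟨p, hp, hpX⟩ := Finset.exists_mem_notMem_of_card_lt_card
      (show X.card < (Finset.Icc 1 m).card by simp; omega)
    obtain ⟨q, hq, hqX⟩ := Finset.exists_mem_notMem_of_card_lt_card
      (show X.card < (Finset.Icc (m + 1) (2 * m)).card by simp; omega)
    have h₁ := odd_card_insert_inter_of_mem hpX hp
    have h₂ : insert q X ∩ Finset.Icc 1 m = X ∩ Finset.Icc 1 m :=
      Finset.insert_inter_of_notMem (by simp at hq ⊢; omega)
    have hpV : p ∈ Finset.Icc 1 (2 * m) \ X := by simp at hp ⊢; exact ⟨by omega, hpX⟩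
    have hqV : q ∈ Finset.Icc 1 (2 * m) \ X := by simp at hq ⊢; exact ⟨by omega, hqX⟩
    rw [← h₂] at h₁
    by_cases h : Odd (insert q X ∩ Finset.Icc 1 m).card
    · exact ⟨q, hqV, p, hpV, h, fun h' => h₁.1 h' h⟩
    · exact ⟨p, hpV, q, hqV, h₁.2 h, h⟩

/-- `A` contains exactly one element of each pair `{i, i + m}` with `1 ≤ i ≤ m`. -/
def IsTransversal (m : ℕ) (A : Finset ℕ) : Prop :=
  ∀ i, 1 ≤ i → i ≤ m → (i ∈ A ↔ i + m ∉ A)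

/-- The transversals other than `{1, …, m-1, 2m}` and `{m, …, 2m-1}`. -/
def IsFlipped (m : ℕ) (A : Finset ℕ) : Prop :=
  IsTransversal m A ∧ ∃ i, 1 ≤ i ∧ i < m ∧ (i ∈ A ↔ m ∈ A)

lemma isFlipped_sdiff {m : ℕ} (A : Finset ℕ) :
    IsFlipped m (Finset.Icc 1 (2 * m) \ A) ↔ IsFlipped m A := by
  have h : ∀ i, 1 ≤ i → i ≤ 2 * m → (i ∈ Finset.Icc 1 (2 * m) \ A ↔ i ∉ A) := by
    intro i h₁ h₂; simp [h₁, h₂]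
  have ht : IsTransversal m (Finset.Icc 1 (2 * m) \ A) ↔ IsTransversal m A := by
    refine forall_congr' fun i => forall_congr' fun h₁ => forall_congr' fun h₂ => ?_
    rw [h i h₁ (by omega), h (i + m) (by omega) (by omega)]
    tauto
  rw [IsFlipped, IsFlipped, ht]
  refine and_congr_right fun _ => exists_congr fun i => and_congr_right fun h₁ =>
    and_congr_right fun h₂ => ?_
  rw [h i h₁ (by omega), h m (by omega) (by omega)]
  tauto

lemma exists_insert_odd_xor_isFlipped {m : ℕ} (hm : 3 ≤ m) {X : Finset ℕ}
    (hX : X ⊆ Finset.Icc 1 (2 * m)) (hc : X.card + 1 = m) :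
    ∃ p ∈ Finset.Icc 1 (2 * m) \ X, ∃ q ∈ Finset.Icc 1 (2 * m) \ X,
      ((p < m ↔ IsFlipped m (insert p X)) ∧ ¬ (q < m ↔ IsFlipped m (insert q X))) := by
  have hV : ∀ i, 1 ≤ i → i ≤ 2 * m → i ∉ X → i ∈ Finset.Icc 1 (2 * m) \ X := by
    intro i h₁ h₂ h₃; simp [h₁, h₂, h₃]
  by_cases htr : ∃ p ∈ Finset.Icc 1 (2 * m) \ X, IsTransversal m (insert p X)
  · obtain ⟨u, hu₁, hum, huX, humX, hu⟩ : ∃ u, 1 ≤ u ∧ u ≤ m ∧ u ∉ X ∧ u + m ∉ X ∧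
        ∀ i, 1 ≤ i → i ≤ m → i ≠ u → (i ∈ X ↔ i + m ∉ X) := by
      obtain ⟨p, hp, h⟩ := htr
      simp only [Finset.mem_sdiff, Finset.mem_Icc] at hp
      by_cases hpm : p ≤ m
      · refine ⟨p, by omega, hpm, hp.2, ?_, ?_⟩
        · have := h p (by omega) hpm
          grind
        · intro i h₁ h₂ h₃
          have := h i h₁ h₂
          grind
      · have hp' : p - m + m = p := by omega
        refine ⟨p - m, by omega, by omega, ?_, by rw [hp']; exact hp.2, ?_⟩
        · have := h (p - m) (by omega) (by omega)
          grind
        · intro i h₁ h₂ h₃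
          have := h i h₁ h₂
          grind
    have htu : IsTransversal m (insert u X) := by
      intro i h₁ h₂
      have := hu i h₁ h₂
      grind
    have htum : IsTransversal m (insert (u + m) X) := by
      intro i h₁ h₂
      have := hu i h₁ h₂
      grind
    have hnt : ∀ q, q ≠ u → q ≠ u + m → ¬ IsFlipped m (insert q X) := by
      intro q h₁ h₂ h
      have := h.1 u hu₁ hum
      grind
    rcases hum.eq_or_lt with rfl | hlt
    · by_cases h₁ : ∃ i, 1 ≤ i ∧ i < u ∧ i ∈ X
      · by_cases h₂ : ∃ i, 1 ≤ i ∧ i < u ∧ i ∉ X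
        · obtain ⟨i, hi₁, hi₂, hi⟩ := h₁
          obtain ⟨j, hj₁, hj₂, hj⟩ := h₂
          refine ⟨i + u, hV _ (by omega) (by omega)
            ((hu i hi₁ hi₂.le hi₂.ne).1 hi), j, hV _ hj₁ (by omega) hj, ?_, ?_⟩
          · have := hnt (i + u) (by omega) (by omega)
            simp [this]
          · have := hnt j (by omega) (by omega)
            simp [this, hj₂]
        · push Not at h₂
          refine ⟨u + u, hV _ (by omega) (by omega) humX, u, hV _ (by omega) (by omega) huX, ?_, ?_⟩
          · have : ¬ IsFlipped u (insert (u + u) X) := by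
              rintro ⟨-, i, hi₁, hi₂, hi⟩
              have := h₂ i hi₁ hi₂
              grind
            simp [this]
          · have : IsFlipped u (insert u X) := by
              refine ⟨htu, 1, le_rfl, by omega, ?_⟩
              have := h₂ 1 le_rfl (by omega)
              grind
            simp [this]
      · push Not at h₁
        refine ⟨u, hV _ (by omega) (by omega) huX, u + u, hV _ (by omega) (by omega) humX, ?_, ?_⟩
        · have : ¬ IsFlipped u (insert u X) := by
            rintro ⟨-, i, hi₁, hi₂, hi⟩
            have := h₁ i hi₁ hi₂
            grind
          simp [this]
        · have : IsFlipped u (insert (u + u) X) := by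
            refine ⟨htum, 1, le_rfl, by omega, ?_⟩
            have := h₁ 1 le_rfl (by omega)
            grind
          simp [this]
    · obtain ⟨q, hq, hqX⟩ : ∃ q, (q = m ∨ q = m + m) ∧ q ∉ X := by
        have := hu m (by omega) le_rfl (by omega)
        by_cases h : m ∈ X
        · exact ⟨m + m, by simp, this.1 h⟩
        · exact ⟨m, by simp, h⟩
      refine ⟨q, hV _ (by omega) (by omega) hqX, ?_⟩
      have hnq := hnt q (by omega) (by omega)
      by_cases h : ∃ i, 1 ≤ i ∧ i < m ∧ i ≠ u ∧ i ∉ X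
      · obtain ⟨i, hi₁, hi₂, hi₃, hi⟩ := h
        refine ⟨i, hV _ hi₁ (by omega) hi, ?_, ?_⟩
        · simp [hnq]; omega
        · have := hnt i hi₃ (by omega)
          simp [this, hi₂]
      · push Not at h
        by_cases hmX : m ∈ X
        · refine ⟨u + m, hV _ (by omega) (by omega) humX, by simp [hnq]; omega, ?_⟩
          have : IsFlipped m (insert (u + m) X) := by
            obtain ⟨i, hi₁, hi₂, hi₃⟩ : ∃ i, 1 ≤ i ∧ i < m ∧ i ≠ u := by
              by_cases h : u = 1
              · exact ⟨2, by omega, by omega, by omega⟩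
              · exact ⟨1, by omega, by omega, by omega⟩
            refine ⟨htum, i, hi₁, hi₂, ?_⟩
            have := h i hi₁ hi₂ hi₃
            grind
          simp [this]
        · refine ⟨u, hV _ (by omega) (by omega) huX, by simp [hnq]; omega, ?_⟩
          have : ¬ IsFlipped m (insert u X) := by
            rintro ⟨-, i, hi₁, hi₂, hi⟩
            have := h i hi₁ hi₂
            grind
          simp [this, hlt]
  · push Not at htr
    have hnf : ∀ p ∈ Finset.Icc 1 (2 * m) \ X, ¬ IsFlipped m (insert p X) :=
      fun p hp h => htr p hp h.1
    obtain ⟨q, hq, hqX⟩ := Finset.exists_mem_notMem_of_card_lt_card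
      (show X.card < (Finset.Icc m (2 * m)).card by simp; omega)
    obtain ⟨p, hp, hpX⟩ : ∃ p ∈ Finset.Icc 1 (m - 1), p ∉ X := by
      by_contra! h
      have hXT : Finset.Icc 1 (m - 1) = X :=
        Finset.eq_of_subset_of_card_le h (by simp; omega)
      refine htr m (hV m (by omega) (by omega) (by simp [← hXT]; omega)) ?_
      intro i h₁ h₂
      simp [← hXT]
      omega
    simp only [Finset.mem_Icc] at hp hq
    have hpV := hV p (by omega) (by omega) hpX
    have hqV := hV q (by omega) (by omega) hqX
    refine ⟨q, hqV, p, hpV, ?_, ?_⟩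
    · simp [hnf q hqV]; omega
    · simp [hnf p hpV]; omega

lemma exists_isBalancedColoring_of_even {m : ℕ} (hm : Even m) (h3 : 3 ≤ m) :
    ∃ c, IsBalancedColoring m c := by
  refine ⟨fun A => (Odd (A ∩ Finset.Icc 1 (m - 1)).card ↔ IsFlipped m A), ?_, ?_⟩
  · intro A _ _
    have h := card_inter_add_card_sdiff_inter
      (show Finset.Icc 1 (m - 1) ⊆ Finset.Icc 1 (2 * m) by intro; simp; omega) A
    simp only [Nat.card_Icc] at h
    have ho : Odd ((Finset.Icc 1 (2 * m) \ A) ∩ Finset.Icc 1 (m - 1)).card ↔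
        ¬ Odd (A ∩ Finset.Icc 1 (m - 1)).card := by grind
    simp only [isFlipped_sdiff, ho]
    tauto
  · intro X hX hc
    have key : ∀ p ∈ Finset.Icc 1 (2 * m) \ X,
        (Odd (insert p X ∩ Finset.Icc 1 (m - 1)).card ↔
          (p < m ↔ ¬ Odd (X ∩ Finset.Icc 1 (m - 1)).card)) := by
      intro p hp
      simp only [Finset.mem_sdiff, Finset.mem_Icc] at hp
      by_cases hpm : p < m
      · rw [odd_card_insert_inter_of_mem hp.2 (by simp; omega)]
        simp [hpm]
      · rw [Finset.insert_inter_of_notMem (by simp; omega)]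
        simp [hpm]
    obtain ⟨p, hp, q, hq, h₁, h₂⟩ := exists_insert_odd_xor_isFlipped h3 hX hc
    have hkp := key p hp
    have hkq := key q hq
    by_cases h : Odd (X ∩ Finset.Icc 1 (m - 1)).card
    · exact ⟨q, hq, p, hp, by tauto, by tauto⟩
    · exact ⟨p, hp, q, hq, by tauto, by tauto⟩

/-- There is an intersecting family of `m`-subsets of `[2m]` whose differences include all
subsets of `[2m]` with fewer than `m` elements. -/
lemma exists_intersecting_family {m : ℕ} (hm : 3 ≤ m) :
    ∃ G : Finset (Finset ℕ),
      (∀ A ∈ G, A ⊆ Finset.Icc 1 (2 * m) ∧ A.card = m) ∧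
      (∀ A ∈ G, ∀ B ∈ G, (A ∩ B).Nonempty) ∧
      (∀ X ⊆ Finset.Icc 1 (2 * m), X.card < m → ∃ A ∈ G, ∃ B ∈ G, X = A \ B) := by
  classical
  obtain ⟨c, hcompl, hstar⟩ : ∃ c, IsBalancedColoring m c :=
    (Nat.even_or_odd m).elim (fun h => exists_isBalancedColoring_of_even h hm)
      exists_isBalancedColoring_of_odd
  set V := Finset.Icc 1 (2 * m) with hVdef
  have hV : V.card = 2 * m := by simp [hVdef]
  have hmem : ∀ A, A ∈ (V.powersetCard m).filter c ↔ (A ⊆ V ∧ A.card = m) ∧ c A := by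
    intro A; simp [Finset.mem_powersetCard]
  refine ⟨(V.powersetCard m).filter c, fun A hA => ((hmem A).1 hA).1, ?_, ?_⟩
  · intro A hA B hB
    rw [hmem] at hA hB
    by_contra h
    rw [Finset.not_nonempty_iff_eq_empty, ← Finset.disjoint_iff_inter_eq_empty] at h
    have hBA : B = V \ A := by
      refine Finset.eq_of_subset_of_card_le
        (Finset.subset_sdiff.2 ⟨hB.1.1, h.symm⟩) ?_
      rw [Finset.card_sdiff_of_subset hA.1.1]
      omega
    exact (hcompl A hA.1.1 hA.1.2).1 (hBA ▸ hB.2) hA.2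
  · have of_inter : ∀ A ⊆ V, A.card = m → c A → ∀ A' ⊆ V, A'.card = m → ¬ c A' →
        ∃ C ∈ (V.powersetCard m).filter c, ∃ D ∈ (V.powersetCard m).filter c,
          A ∩ A' = C \ D := by
      intro A hA hAc hcA A' hA' hA'c hcA'
      refine ⟨A, (hmem A).2 ⟨⟨hA, hAc⟩, hcA⟩, V \ A', (hmem _).2 ⟨⟨Finset.sdiff_subset, ?_⟩,
        (hcompl A' hA' hA'c).2 hcA'⟩, by grind⟩
      rw [Finset.card_sdiff_of_subset hA']
      omega
    intro X hX hXc
    obtain ⟨Y, hXY, hYV, hYc⟩ := Finset.exists_subsuperset_card_eq hX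
      (show X.card ≤ m - 1 by omega) (by omega)
    obtain ⟨p, hp, q, hq, hcp, hcq⟩ := hstar Y hYV (by omega)
    rw [Finset.mem_sdiff] at hp hq
    have hpV : insert p Y ⊆ V := Finset.insert_subset hp.1 hYV
    have hqV : insert q Y ⊆ V := Finset.insert_subset hq.1 hYV
    have hpc : (insert p Y).card = m := by
      rw [Finset.card_insert_of_notMem hp.2]; omega
    have hqc : (insert q Y).card = m := by
      rw [Finset.card_insert_of_notMem hq.2]; omega
    rcases X.eq_empty_or_nonempty with rfl | hne
    · have := (hmem _).2 ⟨⟨hpV, hpc⟩, hcp⟩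
      exact ⟨_, this, _, this, by simp⟩
    have hpos := hne.card_pos
    have hcard : m - X.card ≤ (V \ insert p (insert q Y)).card := by
      rw [Finset.card_sdiff_of_subset (Finset.insert_subset hp.1 hqV)]
      have := Finset.card_insert_le p (insert q Y)
      omega
    obtain ⟨E, hE, hEc⟩ := Finset.exists_subset_card_eq hcard
    have hEd : ∀ e ∈ E, e ∈ V ∧ e ≠ p ∧ e ≠ q ∧ e ∉ Y := by
      intro e he
      have := hE he
      simp only [Finset.mem_sdiff, Finset.mem_insert] at this
      tauto
    have hXE : X ∪ E ⊆ V := Finset.union_subset hX fun e he => (hEd e he).1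
    have hXEc : (X ∪ E).card = m := by
      rw [Finset.card_union_of_disjoint]
      · omega
      · exact Finset.disjoint_left.2 fun x hx hxE => (hEd x hxE).2.2.2 (hXY hx)
    have hinter : ∀ r, (∀ e ∈ E, e ≠ r) → r ∉ Y → (X ∪ E) ∩ insert r Y = X := by
      intro r hr hrY
      ext x
      have h₁ := @hXY x
      have h₂ := hEd x
      have h₃ := hr x
      have h₄ : x = r → x ∉ Y := fun h => h ▸ hrY
      simp only [Finset.mem_inter, Finset.mem_union, Finset.mem_insert]
      tauto
    by_cases hc : c (X ∪ E)
    · have h := of_inter _ hXE hXEc hc _ hqV hqc hcq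
      rwa [hinter q (fun e he => (hEd e he).2.2.1) hq.2] at h
    · have h := of_inter _ hpV hpc hcp _ hXE hXEc hc
      rwa [Finset.inter_comm, hinter p (fun e he => (hEd e he).2.1) hp.2] at h

/-- For every `k ≥ 3` and `1 ≤ t ≤ k-1`, there is a `t`-intersecting family `F`
of `k`-subsets of `[2k-t+1]` such that every subset of `[2k-2t+2]` of size at
most `k-t` is a difference of two members of `F`. -/
theorem stmt_10 (k t : ℕ) (hk : 3 ≤ k) (ht1 : 1 ≤ t) (ht2 : t ≤ k - 1) :
    ∃ F : Finset (Finset ℕ),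
      (∀ A ∈ F, A ⊆ Finset.Icc 1 (2 * k - t + 1) ∧ A.card = k) ∧
      (∀ A ∈ F, ∀ B ∈ F, t ≤ (A ∩ B).card) ∧
      (∀ X ⊆ Finset.Icc 1 (2 * k - 2 * t + 2), X.card ≤ k - t →
        ∃ A ∈ F, ∃ B ∈ F, X = A \ B) := by
  rcases ht2.eq_or_lt with ht | ht
  · refine ⟨(Finset.Icc 1 (k + 1)).powersetCard k, ?_, ?_, ?_⟩
    · intro A hA
      rw [Finset.mem_powersetCard] at hA
      exact ⟨hA.1.trans (Finset.Icc_subset_Icc_right (by omega)), hA.2⟩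
    · intro A hA B hB
      rw [Finset.mem_powersetCard] at hA hB
      have h₁ := Finset.card_union_add_card_inter A B
      have h₂ := Finset.card_le_card (Finset.union_subset hA.1 hB.1)
      simp only [Nat.card_Icc] at h₂
      omega
    · have herase : ∀ x ∈ Finset.Icc 1 (k + 1),
          (Finset.Icc 1 (k + 1)).erase x ∈ (Finset.Icc 1 (k + 1)).powersetCard k := by
        intro x hx
        simp [Finset.mem_powersetCard, Finset.erase_subset, Finset.card_erase_of_mem hx]
      intro X hX hXc
      rcases Finset.card_le_one_iff_subset_singleton.1 (show X.card ≤ 1 by omega) with ⟨x, hx⟩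
      rcases Finset.subset_singleton_iff.1 hx with rfl | rfl
      · exact ⟨_, herase 1 (by simp), _, herase 1 (by simp), by simp⟩
      · have hxV : x ∈ Finset.Icc 1 (k + 1) := by
          have := hX (Finset.mem_singleton_self x)
          simp only [Finset.mem_Icc] at this ⊢
          omega
        obtain ⟨y, hy, hyx⟩ := Finset.exists_mem_ne
          (show 1 < (Finset.Icc 1 (k + 1)).card by simp; omega) x
        exact ⟨_, herase y hy, _, herase x hxV, by grind⟩
  · obtain ⟨G, hG, hint, hdiff⟩ := exists_intersecting_family (show 3 ≤ k - t + 1 by omega)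
    have h2m : 2 * (k - t + 1) = 2 * k - 2 * t + 2 := by omega
    rw [h2m] at hG hdiff
    set S := Finset.Icc (2 * k - 2 * t + 3) (2 * k - t + 1) with hS
    have hSc : S.card = t - 1 := by simp [hS]; omega
    have hdisj : ∀ A ⊆ Finset.Icc 1 (2 * k - 2 * t + 2), Disjoint A S := by
      intro A hA
      refine Finset.disjoint_left.2 fun x hx hxS => ?_
      have := hA hx
      simp only [hS, Finset.mem_Icc] at this hxS
      omega
    refine ⟨G.image (· ∪ S), ?_, ?_, ?_⟩
    · simp only [Finset.forall_mem_image]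
      intro A hA
      obtain ⟨hAV, hAc⟩ := hG A hA
      refine ⟨Finset.union_subset (hAV.trans (Finset.Icc_subset_Icc_right (by omega)))
        (Finset.Icc_subset_Icc_left (by omega)), ?_⟩
      rw [Finset.card_union_of_disjoint (hdisj A hAV)]
      omega
    · simp only [Finset.forall_mem_image]
      intro A hA B hB
      have hpos := (hint A hA B hB).card_pos
      rw [← Finset.inter_union_distrib_right, Finset.card_union_of_disjoint
        (hdisj _ (Finset.inter_subset_left.trans (hG A hA).1))]
      omega
    · intro X hX hXc
      obtain ⟨A, hA, B, hB, rfl⟩ := hdiff X hX (by omega)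
      refine ⟨_, Finset.mem_image_of_mem _ hA, _, Finset.mem_image_of_mem _ hB, ?_⟩
      have := Finset.disjoint_left.1 (hdisj A (hG A hA).1)
      ext x
      have := @this x
      simp only [Finset.mem_sdiff, Finset.mem_union]
      tauto
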